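/- Let X be a metric space, F a finite set of points of X, q ∈ X, and k a natural number, and let Z_k(q, F) denote the influence zone of q with respect to F. Let f ∈ X be a point with f ∉ F such that dist(f, q) > 2 · dist(x, q) for every x ∈ Z_k(q, F). Then Z_k(q, F ∪ {f}) = Z_k(q, F). -/

import Mathlib

open scoped Classical

/-- The influence zone `Z_k(q, F)`: points whose closer-facility count (number of
`a ∈ F`, `a ≠ q`, strictly closer than `q`) is less than `k`. -/
def infZone {X : Type*} [MetricSpace X] (F : Finset X) (q : X) (k : ℕ) : Set X :=
  {x | (F.filter fun a => a ≠ q ∧ dist x a < dist x q).card < k}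

/-- Correctness of InfZone's cheap facility-pruning filter: a facility `f` more than
twice as far from `q` as every point of the influence zone does not change the
influence zone. -/
theorem stmt_10 {X : Type*} [MetricSpace X] (F : Finset X) (q : X) (k : ℕ)
    (f : X) (hf : f ∉ F)
    (hfar : ∀ x ∈ infZone F q k, 2 * dist x q < dist f q) :
    infZone (insert f F) q k = infZone F q k := by
  ext x
  constructor
  · intro hx
    exact lt_of_le_of_lt (Finset.card_le_card
      (Finset.filter_subset_filter _ (Finset.subset_insert f F))) hx
  · intro hx
    have h := hfar x hx
    have hn : ¬ (f ≠ q ∧ dist x f < dist x q) := by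
      rintro ⟨_, h2⟩
      have h3 := dist_triangle f x q
      rw [dist_comm f x] at h3
      linarith
    simp only [infZone, Set.mem_setOf_eq] at hx ⊢
    rw [Finset.filter_insert, if_neg hn]
    exact hx
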